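/- For the k-user MISO broadcast channel with any fixed hybrid CSIT configuration (i.e., any partition of {1,…,k} into 𝒫, 𝒟, 𝒩), the linear degrees-of-freedom region satisfies LDoF_region ⊆ { (d_1,…,d_k) : 0 ≤ d_1,…,d_k ≤ 1; for every i ∈ 𝒟 and every permutation π of 𝒫∪𝒟∖{i}, Σ_{j=1}^{|𝒫|+|𝒟|−1} d_{π(j)}/2^j + d_i + Σ_{j∈𝒩} d_j ≤ 1; for every permutation π of 𝒟, Σ_{j∈𝒫} d_j/k + Σ_{j=1}^{|𝒟|} d_{π(j)}/j + Σ_{j∈𝒩} d_j ≤ 1; and for every i ∈ 𝒫∪𝒟, d_i + Σ_{j∈𝒩} d_j ≤ 1 }. -/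

import Mathlib

open MeasureTheory Matrix Filter Topology

noncomputable section

/-- CSIT state of a receiver: instantaneous (`P`), delayed (`D`), or none (`N`). -/
inductive CSITState : Type
  | P : CSITState
  | D : CSITState
  | N : CSITState
  deriving DecidableEq

/-- A channel realization: for each receiver `j`, time slot `t` and transmit antenna `a`,
the channel coefficient `g j t a`. -/
abbrev Chan (k m n : ℕ) : Type := Fin k → Fin n → Fin m → ℂ

/-- Joint law of the channel coefficients: all entries i.i.d. with common law `μ`. -/
def chanMeasure (k m n : ℕ) (μ : Measure ℂ) : Measure (Chan k m n) :=
  Measure.pi fun _ : Fin k => Measure.pi fun _ : Fin n => Measure.pi fun _ : Fin m => μ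

/-- The block-diagonal channel matrix `G_j^n ∈ ℂ^{n × nm}` of a receiver with
channel vectors `g (t) ∈ ℂ^{1 × m}`. -/
def blockDiag {m n : ℕ} (g : Fin n → Fin m → ℂ) : Matrix (Fin n) (Fin n × Fin m) ℂ :=
  Matrix.of fun t p => if p.1 = t then g t p.2 else 0

/-- A linear coding strategy of block length `n` for the `k`-user MISO BC with `m`
transmit antennas and hybrid CSIT configuration `I`. -/
structure Strategy (k m n : ℕ) (I : Fin k → CSITState) : Type where
  /-- number of information symbols `m_j(n)` for receiver `j` -/
  dim : Fin k → ℕ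
  /-- precoding matrix `V_j(t) ∈ ℂ^{m × m_j(n)}`, a function of the channel realization -/
  pre : (j : Fin k) → Fin n → Chan k m n → Matrix (Fin m) (Fin (dim j)) ℂ
  /-- each precoder is a measurable function of the channels -/
  meas : ∀ j t a c, Measurable fun g => pre j t g a c
  /-- `V_j(t)` depends only on the CSIT available at time `t`: current and past channels of
  receivers with instantaneous CSIT, and strictly past channels of receivers with delayed
  CSIT (and nothing from receivers with no CSIT). -/
  causal : ∀ (j : Fin k) (t : Fin n) (g g' : Chan k m n),
    (∀ i, I i = CSITState.P → ∀ s : Fin n, (s : ℕ) ≤ (t : ℕ) → g i s = g' i s) →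
    (∀ i, I i = CSITState.D → ∀ s : Fin n, (s : ℕ) < (t : ℕ) → g i s = g' i s) →
    pre j t g = pre j t g'

namespace Strategy

variable {k m n : ℕ} {I : Fin k → CSITState}

/-- The overall precoding matrix `V_j^n ∈ ℂ^{nm × m_j(n)}` (vertical concatenation of the
`V_j(t)`). -/
def Vn (f : Strategy k m n I) (j : Fin k) (g : Chan k m n) :
    Matrix (Fin n × Fin m) (Fin (f.dim j)) ℂ :=
  Matrix.of fun r c => f.pre j r.1 g r.2 c

/-- Horizontal concatenation `[∪_{i ∈ S} V_i^n]` of the precoding matrices of the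
receivers in `S`. -/
def VS (f : Strategy k m n I) (S : Finset (Fin k)) (g : Chan k m n) :
    Matrix (Fin n × Fin m) ((i : {x // x ∈ S}) × Fin (f.dim i.1)) ℂ :=
  Matrix.of fun r c => f.Vn c.1.1 g r c.2

/-- The received-signal matrix `G_j^n [∪_{i ∈ S} V_i^n]` at receiver `j`. -/
def recvS (f : Strategy k m n I) (S : Finset (Fin k)) (j : Fin k) (g : Chan k m n) :
    Matrix (Fin n) ((i : {x // x ∈ S}) × Fin (f.dim i.1)) ℂ :=
  blockDiag (g j) * f.VS S g

/-- The received-signal matrix `G_j^n V_j^n` at receiver `j` from its own precoder. -/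
def recv1 (f : Strategy k m n I) (j : Fin k) (g : Chan k m n) :
    Matrix (Fin n) (Fin (f.dim j)) ℂ :=
  blockDiag (g j) * f.Vn j g

/-- `G_j^t [∪_{i ∈ S} V_i^t]`: the received signal matrix restricted to the first `t`
time slots (rows beyond `t` set to zero, so that its rank is that of the truncated
matrix, with the `t = 0` convention of rank `0`). -/
def recvUpTo (f : Strategy k m n I) (S : Finset (Fin k)) (j : Fin k)
    (g : Chan k m n) (t : ℕ) :
    Matrix (Fin n) ((i : {x // x ∈ S}) × Fin (f.dim i.1)) ℂ :=
  Matrix.of fun s c => if (s : ℕ) < t then f.recvS S j g s c else 0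

/-- Decodability: for every receiver `j`, almost surely
`rank[G_j^n[∪_i V_i^n]] − rank[G_j^n[∪_{i ≠ j} V_i^n]] = rank[G_j^n V_j^n] = m_j(n)`. -/
def Decodable (f : Strategy k m n I) (μ : Measure ℂ) : Prop :=
  ∀ j : Fin k, ∀ᵐ g ∂ chanMeasure k m n μ,
    (f.recvS Finset.univ j g).rank - (f.recvS (Finset.univ.erase j) j g).rank
        = (f.recv1 j g).rank ∧
    (f.recv1 j g).rank = f.dim j

end Strategy

/-- A DoF tuple is linearly achievable if there is a sequence of decodable strategies
achieving it in the limit. -/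
def LinAchievable (k m : ℕ) (I : Fin k → CSITState) (μ : Measure ℂ) (d : Fin k → ℝ) : Prop :=
  (∀ j, 0 ≤ d j ∧ d j ≤ 1) ∧
  ∃ F : (n : ℕ) → Strategy k m n I,
    (∀ n, (F n).Decodable μ) ∧
    ∀ j, Tendsto (fun n : ℕ => ((F n).dim j : ℝ) / n) atTop (nhds (d j))

/-- The linear degrees-of-freedom region: closure of the set of linearly achievable tuples. -/
def LDoFRegion (k m : ℕ) (I : Fin k → CSITState) (μ : Measure ℂ) : Set (Fin k → ℝ) :=
  closure {d | LinAchievable k m I μ d}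

/-- The linear sum degrees of freedom. -/
def LDoFSum (k m : ℕ) (I : Fin k → CSITState) (μ : Measure ℂ) : ℝ :=
  sSup ((fun d => ∑ j, d j) '' LDoFRegion k m I μ)

/-- The set `𝒫` of receivers supplying instantaneous CSIT. -/
def stateP (k : ℕ) (I : Fin k → CSITState) : Finset (Fin k) :=
  Finset.univ.filter fun i => I i = CSITState.P

/-- The set `𝒟` of receivers supplying delayed CSIT. -/
def stateD (k : ℕ) (I : Fin k → CSITState) : Finset (Fin k) :=
  Finset.univ.filter fun i => I i = CSITState.D

/-- The set `𝒩` of receivers supplying no CSIT. -/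
def stateN (k : ℕ) (I : Fin k → CSITState) : Finset (Fin k) :=
  Finset.univ.filter fun i => I i = CSITState.N


/-! ### Null sets from null slices -/

/-- A measurable set all of whose slices in the direction of one coordinate are null is null. -/
theorem measure_pi_eq_zero_of_forall_slice {ι : Type*} [Fintype ι] [DecidableEq ι]
    {X : ι → Type*} [∀ i, MeasurableSpace (X i)] (ν : ∀ i, Measure (X i))
    [∀ i, SigmaFinite (ν i)] {B : Set (∀ i, X i)} (hB : MeasurableSet B) (i : ι)
    (h : ∀ x : ∀ i, X i, ν i {y | Function.update x i y ∈ B} = 0) :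
    Measure.pi ν B = 0 := by
  rcases isEmpty_or_nonempty (∀ i, X i) with hX | ⟨⟨x⟩⟩
  · rw [Set.eq_empty_of_isEmpty B, measure_empty]
  rw [← lintegral_indicator_one hB, lintegral_eq_lmarginal_univ (μ := ν) x,
    lmarginal_erase' _ (measurable_one.indicator hB) (Finset.mem_univ i)]
  have hz : (fun x : ∀ i, X i => ∫⁻ y, B.indicator 1 (Function.update x i y) ∂ν i)
      = fun _ => 0 := by
    funext x
    have hm : MeasurableSet {y | Function.update x i y ∈ B} := measurable_update x hB
    rw [← h x, ← lintegral_indicator_one hm]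
    rfl
  rw [hz]
  simp [lmarginal]

theorem chanMeasure_eq_zero_of_forall_slice {k m n : ℕ} (μ : Measure ℂ) [IsProbabilityMeasure μ]
    {B : Set (Chan k m n)} (hB : MeasurableSet B) (a : Fin k) (t : Fin n) (p : Fin m)
    (h : ∀ g : Chan k m n,
      μ {y | Function.update g a (Function.update (g a) t (Function.update (g a t) p y)) ∈ B}
        = 0) :
    chanMeasure k m n μ B = 0 := by
  refine measure_pi_eq_zero_of_forall_slice _ hB a fun g => ?_
  have h₁ := measurable_update g (a := a) hB
  refine measure_pi_eq_zero_of_forall_slice _ h₁ t fun x => ?_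
  have h₂ := measurable_update x (a := t) h₁
  refine measure_pi_eq_zero_of_forall_slice _ h₂ p fun z => ?_
  simpa using h (Function.update g a (Function.update x t z))

/-! ### Measurability of membership in a span -/

theorem mem_span_image_iff_denseSeq {ι C : Type*} [Fintype C] (Q : Finset ι)
    (w : ι → C → ℂ) (v : C → ℂ) :
    v ∈ Submodule.span ℂ (w '' Q) ↔
      ∀ N : ℕ, ∃ l : ℕ, dist v (∑ i : Q, TopologicalSpace.denseSeq (Q → ℂ) l i • w i)
        < 1 / ((N : ℝ) + 1) := by
  have hmem : ∀ c : Q → ℂ, ∑ i : Q, c i • w i ∈ Submodule.span ℂ (w '' Q) := fun c =>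
    Submodule.sum_mem _ fun i _ => Submodule.smul_mem _ _
      (Submodule.subset_span (Set.mem_image_of_mem w i.2))
  have hcont : Continuous fun c : Q → ℂ => ∑ i : Q, c i • w i := by fun_prop
  constructor
  · intro hv N
    obtain ⟨c, hc⟩ := Submodule.mem_span_image_finset_iff_exists_fun ℂ |>.1 hv
    have hv' : v = ∑ i : Q, c i • w i := by
      rw [← hc, ← Finset.sum_coe_sort]
    have hopen : IsOpen {b : Q → ℂ | dist v (∑ i : Q, b i • w i) < 1 / ((N : ℝ) + 1)} :=
      isOpen_lt (continuous_const.dist hcont) continuous_const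
    have hne : {b : Q → ℂ | dist v (∑ i : Q, b i • w i) < 1 / ((N : ℝ) + 1)}.Nonempty :=
      ⟨fun i => c i, by simp only [Set.mem_ofPred_eq, ← hv', dist_self]; positivity⟩
    obtain ⟨_, hb, l, rfl⟩ :=
      (TopologicalSpace.denseRange_denseSeq (Q → ℂ)).inter_open_nonempty _ hopen hne
    exact ⟨l, hb⟩
  · intro h
    have hclosed : IsClosed (Submodule.span ℂ (w '' Q) : Set (C → ℂ)) :=
      Submodule.closed_of_finiteDimensional _
    rw [← SetLike.mem_coe, ← hclosed.closure_eq, Metric.mem_closure_iff]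
    intro ε hε
    obtain ⟨N, hN⟩ := exists_nat_one_div_lt hε
    obtain ⟨l, hl⟩ := h N
    exact ⟨_, hmem _, hl.trans hN⟩

theorem measurableSet_mem_span_image {Ω ι C : Type*} [MeasurableSpace Ω] [Fintype C]
    (Q : Finset ι) {w : ι → Ω → C → ℂ} (hw : ∀ i, Measurable (w i)) {v : Ω → C → ℂ}
    (hv : Measurable v) :
    MeasurableSet {ω | v ω ∈ Submodule.span ℂ ((fun i => w i ω) '' Q)} := by
  simp only [mem_span_image_iff_denseSeq, Set.ofPred_forall, Set.ofPred_exists]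
  refine MeasurableSet.iInter fun N => MeasurableSet.iUnion fun l =>
    measurableSet_lt (hv.dist ?_) measurable_const
  exact Finset.measurable_sum _ fun i _ => (hw i).fun_const_smul _

/-! ### Linear algebra of row spaces -/

section LinearAlgebra

variable {E ι : Type*} [AddCommGroup E] [Module ℂ E] [FiniteDimensional ℂ E]

theorem finrank_sup_add_finrank_le_of_le {W W' : Submodule ℂ E} (X : Submodule ℂ E)
    (h : W ≤ W') :
    Module.finrank ℂ ↥(W' ⊔ X) + Module.finrank ℂ W
      ≤ Module.finrank ℂ W' + Module.finrank ℂ ↥(W ⊔ X) := by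
  have h₁ := Submodule.finrank_sup_add_finrank_inf_eq W' (W ⊔ X)
  rw [← sup_assoc, sup_eq_left.2 h] at h₁
  have h₂ : Module.finrank ℂ W ≤ Module.finrank ℂ ↥(W' ⊓ (W ⊔ X)) :=
    Submodule.finrank_mono (le_inf h le_sup_left)
  omega

theorem finrank_sup_span_image_le (W : Submodule ℂ E) (x : ι → E) (A : Finset ι) :
    Module.finrank ℂ ↥(W ⊔ Submodule.span ℂ (x '' A)) ≤ Module.finrank ℂ W + A.card := by
  have h₁ := Submodule.finrank_add_le_finrank_add_finrank W (Submodule.span ℂ (x '' A))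
  have h₂ : Module.finrank ℂ (Submodule.span ℂ (x '' A)) ≤ A.card := by
    classical
    rw [← Finset.coe_image]
    exact (finrank_span_finset_le_card (A.image x)).trans Finset.card_image_le
  omega

/-- Vectors that are generic in a subspace `T` relative to `W` either are independent modulo
`W`, or together with `W` exhaust `T`. -/
theorem card_le_or_le_sup_span_image [DecidableEq ι] {W T : Submodule ℂ E} {x : ι → E} (A : Finset ι)
    (hgen : ∀ A' ⊆ A, ∀ a ∈ A, a ∉ A' → x a ∈ W ⊔ Submodule.span ℂ (x '' A') →
      T ≤ W ⊔ Submodule.span ℂ (x '' A')) :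
    Module.finrank ℂ W + A.card ≤ Module.finrank ℂ ↥(W ⊔ Submodule.span ℂ (x '' A)) ∨
      T ≤ W ⊔ Submodule.span ℂ (x '' A) := by
  induction A using Finset.induction_on with
  | empty => exact Or.inl (Submodule.finrank_mono le_sup_left)
  | insert a A ha ih =>
    have hle : W ⊔ Submodule.span ℂ (x '' A) ≤ W ⊔ Submodule.span ℂ (x '' (insert a A : Finset ι)) :=
      sup_le_sup_left (Submodule.span_mono (Set.image_mono (by simp))) _
    rcases ih fun A' hA' b hb => hgen A' (hA'.trans (Finset.subset_insert _ _)) b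
      (Finset.mem_insert_of_mem hb) with h | h
    · by_cases hx : x a ∈ W ⊔ Submodule.span ℂ (x '' A)
      · exact Or.inr ((hgen A (Finset.subset_insert _ _) a (Finset.mem_insert_self _ _) ha
          hx).trans hle)
      · left
        have hlt : W ⊔ Submodule.span ℂ (x '' A)
            < W ⊔ Submodule.span ℂ (x '' (insert a A : Finset ι)) := by
          refine lt_of_le_of_ne hle fun heq => hx ?_
          rw [heq]
          exact Submodule.mem_sup_right (Submodule.subset_span ⟨a, by simp, rfl⟩)
        have := Submodule.finrank_lt_finrank_of_lt hlt
        rw [Finset.card_insert_of_notMem ha]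
        omega
    · exact Or.inr (h.trans hle)

theorem card_mul_finrank_sup_span_le [DecidableEq ι] {W W' T : Submodule ℂ E} {x : ι → E}
    {A B : Finset ι} (hW : W ≤ W') (hAB : A ⊆ B) (hT : ∀ b, x b ∈ T)
    (hgen : ∀ A' ⊆ A, ∀ a ∈ A, a ∉ A' → x a ∈ W ⊔ Submodule.span ℂ (x '' A') →
      T ≤ W ⊔ Submodule.span ℂ (x '' A'))
    (h : A.card * Module.finrank ℂ W' ≤ B.card * Module.finrank ℂ W) :
    A.card * Module.finrank ℂ ↥(W' ⊔ Submodule.span ℂ (x '' B))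
      ≤ B.card * Module.finrank ℂ ↥(W ⊔ Submodule.span ℂ (x '' A)) := by
  have hcard := Finset.card_le_card hAB
  rcases card_le_or_le_sup_span_image A hgen with h₁ | h₁
  · have h₂ := finrank_sup_span_image_le W' x B
    calc _ ≤ A.card * (Module.finrank ℂ W' + B.card) := Nat.mul_le_mul_left _ h₂
      _ ≤ B.card * (Module.finrank ℂ W + A.card) := by nlinarith
      _ ≤ _ := Nat.mul_le_mul_left _ h₁
  · have h₂ : W' ⊔ Submodule.span ℂ (x '' B) ≤ W' ⊔ Submodule.span ℂ (x '' A) := by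
      refine sup_le le_sup_left ?_
      refine (Submodule.span_le.2 ?_ : _ ≤ T).trans (h₁.trans (sup_le_sup_right hW _))
      rintro _ ⟨b, -, rfl⟩
      exact hT b
    have h₃ := Submodule.finrank_mono h₂
    have h₄ := finrank_sup_add_finrank_le_of_le (Submodule.span ℂ (x '' A)) hW
    have h₅ : Module.finrank ℂ W ≤ Module.finrank ℂ ↥(W ⊔ Submodule.span ℂ (x '' A)) :=
      Submodule.finrank_mono le_sup_left
    obtain ⟨δ, hδ⟩ := Nat.exists_eq_add_of_le h₅
    have h₆ : Module.finrank ℂ ↥(W' ⊔ Submodule.span ℂ (x '' B)) ≤ Module.finrank ℂ W' + δ := by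
      omega
    rw [hδ]
    calc _ ≤ A.card * (Module.finrank ℂ W' + δ) := Nat.mul_le_mul_left _ h₆
      _ ≤ _ := by nlinarith

theorem finrank_map_add_finrank_inf_ker {F : Type*} [AddCommGroup F] [Module ℂ F]
    (φ : E →ₗ[ℂ] F) (R : Submodule ℂ E) :
    Module.finrank ℂ (R.map φ) + Module.finrank ℂ ↥(R ⊓ LinearMap.ker φ)
      = Module.finrank ℂ R := by
  have h := LinearMap.finrank_range_add_finrank_ker (φ.domRestrict R)
  rw [LinearMap.range_domRestrict, LinearMap.ker_domRestrict] at h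
  rw [← h, ← Submodule.map_comap_subtype, Submodule.finrank_map_subtype_eq]

end LinearAlgebra

namespace Strategy

variable {k m n : ℕ} {I : Fin k → CSITState}

/-! ### Row spaces of received signals -/

/-- Index set of all information symbols. -/
abbrev Sym (f : Strategy k m n I) : Type := (j : Fin k) × Fin (f.dim j)

/-- Coordinate projection onto the symbols intended for the receivers in `S`. -/
def mask (f : Strategy k m n I) (S : Finset (Fin k)) : (f.Sym → ℂ) →ₗ[ℂ] (f.Sym → ℂ) where
  toFun v c := if c.1 ∈ S then v c else 0
  map_add' v w := by funext c; by_cases h : c.1 ∈ S <;> simp [h]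
  map_smul' b v := by funext c; by_cases h : c.1 ∈ S <;> simp [h]

theorem mask_apply (f : Strategy k m n I) (S : Finset (Fin k)) (v : f.Sym → ℂ) (c : f.Sym) :
    f.mask S v c = if c.1 ∈ S then v c else 0 := rfl

/-- Row of antenna `p` in the joint precoding matrix of the receivers in `S` at time `t`. -/
def txRow (f : Strategy k m n I) (S : Finset (Fin k)) (g : Chan k m n) (t : Fin n)
    (p : Fin m) : f.Sym → ℂ :=
  f.mask S fun c => f.pre c.1 t g p c.2

/-- Coefficients of the symbols of `S` in the signal received by receiver `q.1` at time `q.2`. -/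
def rxRow (f : Strategy k m n I) (S : Finset (Fin k)) (g : Chan k m n) (q : Fin k × Fin n) :
    f.Sym → ℂ :=
  ∑ p, g q.1 q.2 p • f.txRow S g q.2 p

/-- Span of the received rows indexed by `Q`. -/
def rowSpace (f : Strategy k m n I) (S : Finset (Fin k)) (g : Chan k m n)
    (Q : Finset (Fin k × Fin n)) : Submodule ℂ (f.Sym → ℂ) :=
  Submodule.span ℂ (f.rxRow S g '' Q)

/-- The rank of the symbols of `S` in the signals jointly received by the receivers in `A`. -/
def rk (f : Strategy k m n I) (g : Chan k m n) (S A : Finset (Fin k)) : ℕ :=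
  Module.finrank ℂ (f.rowSpace S g (A ×ˢ Finset.univ))

variable (f : Strategy k m n I)

theorem rowSpace_mono (S : Finset (Fin k)) (g : Chan k m n) {Q Q' : Finset (Fin k × Fin n)}
    (h : Q ⊆ Q') : f.rowSpace S g Q ≤ f.rowSpace S g Q' :=
  Submodule.span_mono (Set.image_mono (by exact_mod_cast h))

theorem rxRow_mem_rowSpace (S : Finset (Fin k)) (g : Chan k m n) {Q : Finset (Fin k × Fin n)}
    {q : Fin k × Fin n} (h : q ∈ Q) : f.rxRow S g q ∈ f.rowSpace S g Q :=
  Submodule.subset_span ⟨q, by exact_mod_cast h, rfl⟩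

theorem rxRow_mem_span_txRow (S : Finset (Fin k)) (g : Chan k m n) (q : Fin k × Fin n) :
    f.rxRow S g q ∈ Submodule.span ℂ (Set.range (f.txRow S g q.2)) :=
  Submodule.sum_mem _ fun p _ => Submodule.smul_mem _ _ (Submodule.subset_span ⟨p, rfl⟩)

theorem rowSpace_union (S : Finset (Fin k)) (g : Chan k m n) (Q Q' : Finset (Fin k × Fin n)) :
    f.rowSpace S g (Q ∪ Q') = f.rowSpace S g Q ⊔ f.rowSpace S g Q' := by
  rw [rowSpace, Finset.coe_union, Set.image_union, Submodule.span_union]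
  rfl

theorem finrank_rowSpace_le (S : Finset (Fin k)) (g : Chan k m n)
    (Q : Finset (Fin k × Fin n)) : Module.finrank ℂ (f.rowSpace S g Q) ≤ Q.card := by
  have h := finrank_sup_span_image_le (⊥ : Submodule ℂ (f.Sym → ℂ)) (f.rxRow S g) Q
  rwa [bot_sup_eq, finrank_bot, zero_add] at h

theorem mask_mask (S T : Finset (Fin k)) (v : f.Sym → ℂ) :
    f.mask S (f.mask T v) = f.mask (S ∩ T) v := by
  funext c
  by_cases h : c.1 ∈ S <;> by_cases h' : c.1 ∈ T <;> simp [mask_apply, h, h']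

theorem mask_rxRow (S T : Finset (Fin k)) (g : Chan k m n) (q : Fin k × Fin n) :
    f.mask S (f.rxRow T g q) = f.rxRow (S ∩ T) g q := by
  simp only [rxRow, map_sum, map_smul, txRow, mask_mask]

theorem map_mask_rowSpace (S T : Finset (Fin k)) (g : Chan k m n)
    (Q : Finset (Fin k × Fin n)) :
    (f.rowSpace T g Q).map (f.mask S) = f.rowSpace (S ∩ T) g Q := by
  rw [rowSpace, Submodule.map_span, ← Set.image_comp, rowSpace]
  congr 2
  funext q
  exact f.mask_rxRow S T g q

/-! ### Genericity of the channels -/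

theorem measurable_txRow (S : Finset (Fin k)) (t : Fin n) (p : Fin m) :
    Measurable fun g => f.txRow S g t p := by
  refine measurable_pi_lambda _ fun c => ?_
  simp only [txRow, mask_apply]
  by_cases h : c.1 ∈ S
  · simpa [h] using f.meas c.1 t p c.2
  · simp [h]

theorem measurable_rxRow (S : Finset (Fin k)) (q : Fin k × Fin n) :
    Measurable fun g => f.rxRow S g q := by
  refine measurable_pi_lambda _ fun c => ?_
  simp only [rxRow, Finset.sum_apply, Pi.smul_apply, smul_eq_mul]
  refine Finset.measurable_sum _ fun p _ => Measurable.mul ?_ ?_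
  · fun_prop
  · exact (measurable_pi_apply c).comp (f.measurable_txRow S q.2 p)

/-- If the precoders at time `t` and at the times in `Q` ignore the channel of receiver `a` at
time `t`, then almost surely the row received by `a` at time `t` is not in the span of those
indexed by `Q`, unless everything sent at time `t` is. -/
theorem ae_txRow_mem_of_rxRow_mem (μ : Measure ℂ) [IsProbabilityMeasure μ] [NullSingletonClass μ]
    (S : Finset (Fin k)) (a : Fin k) (t : Fin n) (Q : Finset (Fin k × Fin n))
    (hQ : (a, t) ∉ Q)
    (hcausal : ∀ s, (s = t ∨ ∃ i, (i, s) ∈ Q) → ∀ (j : Fin k) (g : Chan k m n) (x : Fin m → ℂ),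
      f.pre j s (Function.update g a (Function.update (g a) t x)) = f.pre j s g) :
    ∀ᵐ g ∂chanMeasure k m n μ, f.rxRow S g (a, t) ∈ f.rowSpace S g Q →
      ∀ p, f.txRow S g t p ∈ f.rowSpace S g Q := by
  simp only [imp_forall_iff, ae_all_iff]
  intro p
  rw [ae_iff]
  have hm : MeasurableSet {g : Chan k m n |
      ¬ (f.rxRow S g (a, t) ∈ f.rowSpace S g Q → f.txRow S g t p ∈ f.rowSpace S g Q)} := by
    simp only [Classical.not_imp]
    exact (measurableSet_mem_span_image Q (f.measurable_rxRow S) (f.measurable_rxRow S _)).inter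
      (measurableSet_mem_span_image Q (f.measurable_rxRow S) (f.measurable_txRow S t p)).compl
  refine chanMeasure_eq_zero_of_forall_slice μ hm a t p fun g => ?_
  set u : ℂ → Chan k m n := fun y =>
    Function.update g a (Function.update (g a) t (Function.update (g a t) p y)) with hu
  have htx : ∀ s, (s = t ∨ ∃ i, (i, s) ∈ Q) → ∀ y, f.txRow S (u y) s = f.txRow S g s := by
    intro s hs y
    funext b
    simp only [txRow, hu, hcausal s hs]
  have hrow : ∀ y, f.rowSpace S (u y) Q = f.rowSpace S g Q := by
    intro y
    rw [rowSpace, rowSpace]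
    congr 1
    refine Set.image_congr fun q hq => ?_
    have hq' : q ∈ Q := by exact_mod_cast hq
    have hqe : u y q.1 q.2 = g q.1 q.2 := by
      by_cases h₁ : q.1 = a
      · have h₂ : q.2 ≠ t := fun h => hQ (by rwa [← h₁, ← h])
        simp [hu, h₁, h₂]
      · simp [hu, h₁]
    simp only [rxRow, htx q.2 (Or.inr ⟨q.1, hq'⟩), hqe]
  have hrx : ∀ y y', f.rxRow S (u y) (a, t) - f.rxRow S (u y') (a, t)
      = (y - y') • f.txRow S g t p := by
    intro y y'
    simp only [rxRow, htx t (Or.inl rfl), ← Finset.sum_sub_distrib, ← sub_smul]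
    rw [Finset.sum_eq_single p]
    · simp [hu]
    · intro b _ hb
      simp [hu, hb]
    · simp
  refine Set.Subsingleton.measure_zero (fun y hy y' hy' => ?_) μ
  change ¬ (f.rxRow S (u y) (a, t) ∈ f.rowSpace S (u y) Q →
    f.txRow S (u y) t p ∈ f.rowSpace S (u y) Q) at hy
  change ¬ (f.rxRow S (u y') (a, t) ∈ f.rowSpace S (u y') Q →
    f.txRow S (u y') t p ∈ f.rowSpace S (u y') Q) at hy'
  rw [hrow, htx t (Or.inl rfl), Classical.not_imp] at hy hy'
  by_contra hne
  refine hy.2 ?_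
  have hsub := Submodule.sub_mem _ hy.1 hy'.1
  rw [hrx] at hsub
  exact (Submodule.smul_mem_iff _ (sub_ne_zero.2 hne)).1 hsub

/-- The channel realization `g` is generic for the strategy: a received row whose channel is
unknown to the relevant precoders is new unless everything sent at that time is already known. -/
def Generic (f : Strategy k m n I) (g : Chan k m n) : Prop :=
  ∀ (S : Finset (Fin k)) (a : Fin k) (t : Fin n) (Q : Finset (Fin k × Fin n)), (a, t) ∉ Q →
    (I a = CSITState.N ∨ (I a = CSITState.D ∧ ∀ q ∈ Q, q.2 ≤ t)) →
    f.rxRow S g (a, t) ∈ f.rowSpace S g Q → ∀ p, f.txRow S g t p ∈ f.rowSpace S g Q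

theorem ae_generic (μ : Measure ℂ) [IsProbabilityMeasure μ] [NullSingletonClass μ] :
    ∀ᵐ g ∂chanMeasure k m n μ, f.Generic g := by
  simp only [Generic, ae_all_iff (μ := chanMeasure k m n μ)]
  intro S a t Q hQ hI
  have key := f.ae_txRow_mem_of_rxRow_mem μ S a t Q hQ ?_
  · simpa only [imp_forall_iff, ae_all_iff] using key
  intro s hs j g x
  refine f.causal j s _ _ (fun i hi s' _ => ?_) fun i hi s' hs' => ?_
  · have : i ≠ a := by
      rintro rfl
      simp [hi] at hI
    simp [this]
  · by_cases hia : i = a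
    · subst hia
      obtain ⟨-, hle⟩ := hI.resolve_left (by simp [hi])
      have hst : s ≤ t := by
        rcases hs with rfl | ⟨i', hi'⟩
        · exact le_rfl
        · exact hle _ hi'
      have : s' ≠ t := fun h => by
        subst h
        exact absurd hs' (not_lt.2 hst)
      simp [this]
    · simp [hia]

/-! ### Rank inequalities for generic channels -/

theorem rk_mono (g : Chan k m n) (S : Finset (Fin k)) {A B : Finset (Fin k)} (h : A ⊆ B) :
    f.rk g S A ≤ f.rk g S B :=
  Submodule.finrank_mono (f.rowSpace_mono S g (Finset.product_subset_product_left h))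

theorem rk_singleton_le (g : Chan k m n) (S : Finset (Fin k)) (i : Fin k) :
    f.rk g S {i} ≤ n :=
  (f.finrank_rowSpace_le S g _).trans (by simp)

variable {f}

/-- Delayed CSIT receivers in `A` receive at least the fraction `|A| / |B|` of what the
receivers in `B ⊇ A` receive jointly. -/
theorem Generic.card_mul_rk_le {g : Chan k m n} (hg : f.Generic g) (S : Finset (Fin k))
    {A B : Finset (Fin k)} (hAB : A ⊆ B) (hA : ∀ a ∈ A, I a = CSITState.D) :
    A.card * f.rk g S B ≤ B.card * f.rk g S A := by
  let past : ℕ → Finset (Fin n) := fun τ => Finset.univ.filter fun s => (s : ℕ) < τ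
  have hrow : ∀ (t : Fin n) (A : Finset (Fin k)) (A' : Finset (Fin k)),
      f.rowSpace S g (A ×ˢ past t) ⊔ Submodule.span ℂ ((fun a => f.rxRow S g (a, t)) '' A')
        = f.rowSpace S g (A ×ˢ past t ∪ A' ×ˢ {t}) := by
    intro t A A'
    rw [rowSpace_union, rowSpace, rowSpace]
    congr 2
    rw [Finset.coe_product, Finset.coe_singleton, Set.prod_singleton, ← Set.image_comp]
    rfl
  have hsucc : ∀ (t : Fin n) (A : Finset (Fin k)),
      A ×ˢ past (t + 1) = A ×ˢ past t ∪ A ×ˢ {t} := by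
    intro t A
    ext ⟨a, s⟩
    simp only [past, Finset.mem_product, Finset.mem_filter, Finset.mem_univ, true_and,
      Finset.mem_union, Finset.mem_singleton, Fin.ext_iff]
    rw [← and_or_left, Nat.lt_succ_iff_lt_or_eq]
  have key : ∀ τ ≤ n, A.card * Module.finrank ℂ (f.rowSpace S g (B ×ˢ past τ))
      ≤ B.card * Module.finrank ℂ (f.rowSpace S g (A ×ˢ past τ)) := by
    intro τ
    induction τ with
    | zero =>
      have h : past 0 = ∅ := by simp [past]
      have h₀ : Module.finrank ℂ (f.rowSpace S g (B ×ˢ past 0)) = 0 :=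
        Nat.le_zero.1 ((f.finrank_rowSpace_le S g _).trans (by simp [h]))
      rw [h₀, mul_zero]
      exact fun _ => Nat.zero_le _
    | succ τ ih =>
      intro hτ
      let t : Fin n := ⟨τ, hτ⟩
      have h := card_mul_finrank_sup_span_le
        (T := Submodule.span ℂ (Set.range (f.txRow S g t))) (x := fun a => f.rxRow S g (a, t))
        (f.rowSpace_mono S g (Finset.product_subset_product_left hAB)) hAB
        (fun b => f.rxRow_mem_span_txRow S g (b, t)) ?_ (ih (by omega))
      · rw [hrow t, hrow t, ← hsucc, ← hsucc] at h
        exact h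
      intro A' hA' a ha haA' hx
      rw [hrow t] at hx ⊢
      rw [Submodule.span_le]
      rintro _ ⟨p, rfl⟩
      refine hg S a t _ ?_ (Or.inr ⟨hA a ha, ?_⟩) hx p
      · simp [past, haA', t]
      · rintro ⟨b, s⟩ hq
        simp only [past, Finset.mem_union, Finset.mem_product, Finset.mem_filter,
          Finset.mem_univ, true_and, Finset.mem_singleton] at hq
        rcases hq with ⟨-, hs⟩ | ⟨-, hs⟩
        · exact hs.le
        · exact hs.le
  have hfull : past n = Finset.univ := by
    simp [past]
  have h := key n le_rfl
  rwa [hfull] at h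

/-- A receiver without CSIT receives at least the rank received by any other receiver. -/
theorem Generic.rk_le_of_noCSIT {g : Chan k m n} (hg : f.Generic g) (S : Finset (Fin k))
    {j : Fin k} (hj : I j = CSITState.N) (i : Fin k) :
    f.rk g S {i} ≤ f.rk g S {j} := by
  by_cases hij : i = j
  · rw [hij]
  let base : ℕ → Finset (Fin k × Fin n) := fun τ =>
    {j} ×ˢ Finset.univ.filter (fun s : Fin n => (s : ℕ) < τ) ∪
      {i} ×ˢ Finset.univ.filter (fun s : Fin n => τ < (s : ℕ) + 1)
  have key : ∀ τ ≤ n, f.rk g S {i} ≤ Module.finrank ℂ (f.rowSpace S g (base τ)) := by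
    intro τ
    induction τ with
    | zero =>
      have h : base 0 = {i} ×ˢ Finset.univ := by simp [base]
      intro _
      rw [h, rk]
    | succ τ ih =>
      intro hτ
      refine (ih (by omega)).trans ?_
      let t : Fin n := ⟨τ, hτ⟩
      let Q := (base τ).erase (i, t)
      have h₁ : base τ = insert (i, t) Q := (Finset.insert_erase (by simp [base, t])).symm
      have h₂ : base (τ + 1) = insert (j, t) Q := by
        ext ⟨a, s⟩
        simp only [base, Q, t, Finset.mem_union, Finset.mem_product, Finset.mem_singleton,
          Finset.mem_filter, Finset.mem_univ, true_and, Finset.mem_insert, Finset.mem_erase,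
          Prod.mk.injEq, ne_eq, Fin.ext_iff]
        have : (i : ℕ) ≠ j := fun h => hij (Fin.ext h)
        omega
      have hjQ : (j, t) ∉ Q := by
        simp [Q, base, t, hij, Ne.symm hij]
      by_cases hx : f.rxRow S g (j, t) ∈ f.rowSpace S g Q
      · refine Submodule.finrank_mono (?_ : _ ≤ f.rowSpace S g Q) |>.trans
          (Submodule.finrank_mono (f.rowSpace_mono S g (h₂ ▸ Finset.subset_insert _ _)))
        have hp := hg S j t Q hjQ (Or.inl hj) hx
        rw [h₁, rowSpace, Submodule.span_le]
        rintro _ ⟨q, hq, rfl⟩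
        rcases Finset.mem_insert.1 (Finset.mem_coe.1 hq) with rfl | hq
        · exact Submodule.sum_mem _ fun p _ => Submodule.smul_mem _ _ (hp p)
        · exact f.rxRow_mem_rowSpace S g hq
      · have hlt : f.rowSpace S g Q < f.rowSpace S g (base (τ + 1)) := by
          refine lt_of_le_of_ne (f.rowSpace_mono S g (h₂ ▸ Finset.subset_insert _ _)) fun h => hx ?_
          rw [h, h₂]
          exact f.rxRow_mem_rowSpace S g (Finset.mem_insert_self _ _)
        have h₃ := Submodule.finrank_lt_finrank_of_lt hlt
        have h₄ := finrank_sup_span_image_le (f.rowSpace S g Q) (f.rxRow S g) {(i, t)}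
        have h₅ : f.rowSpace S g Q ⊔ Submodule.span ℂ (f.rxRow S g '' ({(i, t)} : Finset _))
            = f.rowSpace S g (base τ) := by
          rw [h₁, Finset.insert_eq, Finset.union_comm, rowSpace_union]
          rfl
        rw [h₅, Finset.card_singleton] at h₄
        omega
  have hfull : base n = {j} ×ˢ Finset.univ := by
    ext ⟨a, s⟩
    have := s.2
    simp only [base, Finset.mem_union, Finset.mem_product, Finset.mem_singleton,
      Finset.mem_filter, Finset.mem_univ, true_and, and_true]
    omega
  have h := key n le_rfl
  rwa [hfull] at h

/-! ### Decodability in terms of row spaces -/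

variable (f)

theorem rank_recvS (S : Finset (Fin k)) (j : Fin k) (g : Chan k m n) :
    (f.recvS S j g).rank = f.rk g S {j} := by
  let ε : (((i : {x // x ∈ S}) × Fin (f.dim i.1)) → ℂ) →ₗ[ℂ] (f.Sym → ℂ) :=
    { toFun := fun v c => if h : c.1 ∈ S then v ⟨⟨c.1, h⟩, c.2⟩ else 0
      map_add' := fun v w => by funext c; by_cases h : c.1 ∈ S <;> simp [h]
      map_smul' := fun b v => by funext c; by_cases h : c.1 ∈ S <;> simp [h] }
  have hε : Function.Injective ε := by
    intro v w hvw
    funext c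
    have := congrFun hvw ⟨c.1.1, c.2⟩
    simpa [ε, c.1.2] using this
  have hrow : ∀ s, ε ((f.recvS S j g).row s) = f.rxRow S g (j, s) := by
    intro s
    funext c
    by_cases h : c.1 ∈ S <;>
      simp [ε, h, recvS, VS, Vn, _root_.blockDiag, Matrix.mul_apply, rxRow, txRow, mask_apply,
        Fintype.sum_prod_type]
  rw [Matrix.rank_eq_finrank_span_row, (Submodule.equivMapOfInjective ε hε _).finrank_eq,
    Submodule.map_span, ← Set.range_comp, rk, rowSpace]
  have hset : Set.range (ε ∘ (f.recvS S j g).row)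
      = f.rxRow S g '' (({j} ×ˢ Finset.univ : Finset (Fin k × Fin n)) : Set _) := by
    ext v
    simp [hrow]
  rw [hset]

/-- Symbols of receiver `j` are decodable on `g`: every functional of the symbols of `j`
is received by `j`, and these symbols number `m_j`. -/
def Separates (f : Strategy k m n I) (g : Chan k m n) (j : Fin k) : Prop :=
  LinearMap.ker (f.mask (Finset.univ.erase j)) ≤ f.rowSpace Finset.univ g ({j} ×ˢ Finset.univ) ∧
    Module.finrank ℂ (LinearMap.ker (f.mask (Finset.univ.erase j))) = f.dim j

theorem mem_ker_mask_erase {j : Fin k} {v : f.Sym → ℂ} :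
    v ∈ LinearMap.ker (f.mask (Finset.univ.erase j)) ↔ ∀ c : f.Sym, c.1 ≠ j → v c = 0 := by
  rw [LinearMap.mem_ker, funext_iff]
  simp [mask_apply]

theorem finrank_ker_mask_erase_le (j : Fin k) :
    Module.finrank ℂ (LinearMap.ker (f.mask (Finset.univ.erase j))) ≤ f.dim j := by
  let ρ : LinearMap.ker (f.mask (Finset.univ.erase j)) →ₗ[ℂ] (Fin (f.dim j) → ℂ) :=
    (LinearMap.funLeft ℂ ℂ fun c => (⟨j, c⟩ : f.Sym)).domRestrict _
  have hρ : Function.Injective ρ := by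
    rintro ⟨v, hv⟩ ⟨w, hw⟩ h
    rw [mem_ker_mask_erase] at hv hw
    ext ⟨i, c⟩
    by_cases hi : i = j
    · subst hi
      exact congrFun h c
    · simp [hv ⟨i, c⟩ hi, hw ⟨i, c⟩ hi]
  simpa using LinearMap.finrank_le_finrank_of_injective hρ

theorem separates_of_rank_eq {g : Chan k m n} {j : Fin k}
    (h : (f.recvS Finset.univ j g).rank - (f.recvS (Finset.univ.erase j) j g).rank
        = (f.recv1 j g).rank ∧ (f.recv1 j g).rank = f.dim j) :
    f.Separates g j := by
  rw [rank_recvS, rank_recvS, rk, rk] at h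
  have h₁ := finrank_map_add_finrank_inf_ker (f.mask (Finset.univ.erase j))
    (f.rowSpace Finset.univ g ({j} ×ˢ Finset.univ))
  rw [map_mask_rowSpace, Finset.inter_univ] at h₁
  have h₂ := f.finrank_ker_mask_erase_le j
  have h₃ := Submodule.finrank_mono (inf_le_right :
    f.rowSpace Finset.univ g ({j} ×ˢ Finset.univ) ⊓ LinearMap.ker (f.mask (Finset.univ.erase j))
      ≤ LinearMap.ker (f.mask (Finset.univ.erase j)))
  have h₄ := Submodule.eq_of_le_of_finrank_le (inf_le_right :
    f.rowSpace Finset.univ g ({j} ×ˢ Finset.univ) ⊓ LinearMap.ker (f.mask (Finset.univ.erase j))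
      ≤ LinearMap.ker (f.mask (Finset.univ.erase j))) (by omega)
  exact ⟨inf_eq_right.1 h₄, by omega⟩

variable {f}

theorem Separates.dim_add_rk_le {g : Chan k m n} {j : Fin k} (h : f.Separates g j)
    {S A : Finset (Fin k)} (hS : j ∈ S) (hA : j ∈ A) :
    f.dim j + f.rk g (S.erase j) A ≤ f.rk g S A := by
  have h₁ := finrank_map_add_finrank_inf_ker (f.mask (Finset.univ.erase j))
    (f.rowSpace S g (A ×ˢ Finset.univ))
  rw [map_mask_rowSpace, Finset.erase_inter, Finset.univ_inter] at h₁
  have hle : LinearMap.ker (f.mask (Finset.univ.erase j)) ≤ f.rowSpace S g (A ×ˢ Finset.univ) := by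
    intro v hv
    have hmem : f.mask S v ∈ f.rowSpace S g (A ×ˢ Finset.univ) := by
      have hv' := Submodule.mem_map_of_mem (f := f.mask S) (f.rowSpace_mono Finset.univ g
        (Finset.product_subset_product_left (Finset.singleton_subset_iff.2 hA)) (h.1 hv))
      rwa [map_mask_rowSpace, Finset.inter_univ] at hv'
    convert hmem using 1
    funext c
    rw [mask_apply]
    split_ifs with hc
    · rfl
    · exact (f.mem_ker_mask_erase).1 hv c fun hcj => hc (hcj ▸ hS)
  rw [inf_eq_right.2 hle, h.2] at h₁
  rw [rk, rk]
  omega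

/-! ### Bounds on the numbers of symbols -/

variable {g : Chan k m n}

theorem sum_dim_le_rk (hsep : ∀ j, f.Separates g j) (T : Finset (Fin k)) :
    ∀ {S A : Finset (Fin k)}, T ⊆ S → T ⊆ A → ∑ j ∈ T, f.dim j ≤ f.rk g S A := by
  induction T using Finset.induction_on with
  | empty => simp
  | insert a T ha ih =>
    intro S A hS hA
    rw [Finset.insert_subset_iff] at hS hA
    have h₁ := (hsep a).dim_add_rk_le hS.1 hA.1
    have h₂ := ih (S := S.erase a) (A := A)
      (fun x hx => Finset.mem_erase.2 ⟨fun h => ha (h ▸ hx), hS.2 hx⟩) hA.2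
    rw [Finset.sum_insert ha]
    omega

/-- The symbols of the receivers without CSIT occupy dimensions of the signal space that are
not available for the other receivers. -/
theorem sum_dim_noCSIT_add_rk_le (hg : f.Generic g) (hsep : ∀ j, f.Separates g j)
    (T : Finset (Fin k)) (hT : ∀ j ∈ T, I j = CSITState.N) (i : Fin k) :
    ∑ j ∈ T, f.dim j + f.rk g (Finset.univ \ T) {i} ≤ n := by
  induction T using Finset.induction_on generalizing i with
  | empty => simpa using f.rk_singleton_le g _ i
  | insert a T ha ih =>
    have h₁ := ih (fun j hj => hT j (Finset.mem_insert_of_mem hj)) a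
    have h₂ := (hsep a).dim_add_rk_le (S := Finset.univ \ T) (A := {a}) (by simpa using ha)
      (by simp)
    have h₃ := hg.rk_le_of_noCSIT ((Finset.univ \ T).erase a) (hT a (Finset.mem_insert_self _ _)) i
    have h₄ : Finset.univ \ insert a T = (Finset.univ \ T).erase a := by
      ext x; simp [not_or]
    rw [Finset.sum_insert ha, h₄]
    omega

theorem sum_dim_noCSIT_le (hg : f.Generic g) (hsep : ∀ j, f.Separates g j)
    (T : Finset (Fin k)) (hT : ∀ j ∈ T, I j = CSITState.N) :
    ∑ j ∈ T, f.dim j ≤ n := by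
  rcases T.eq_empty_or_nonempty with rfl | ⟨i, -⟩
  · simp
  · exact (Nat.le_add_right _ _).trans (sum_dim_noCSIT_add_rk_le hg hsep T hT i)

/-- A delayed CSIT receiver sees at least half of the dimension occupied by any interferer. -/
theorem sum_dim_div_two_pow_le_rk (hg : f.Generic g) (hsep : ∀ j, f.Separates g j)
    {i : Fin k} (hi : I i = CSITState.D) {r : ℕ} (e : Fin r → Fin k)
    (he : Function.Injective e) (hei : ∀ l, e l ≠ i) (S : Finset (Fin k)) (hS : ∀ l, e l ∈ S) :
    ∑ l, (f.dim (e l) : ℝ) / 2 ^ ((l : ℕ) + 1) ≤ f.rk g S {i} := by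
  induction r generalizing S with
  | zero => simp
  | succ r ih =>
    have h₁ := hg.card_mul_rk_le S (A := {i}) (B := {i, e 0}) (by simp) (by simpa using hi)
    have h₂ := (hsep (e 0)).dim_add_rk_le (A := {i, e 0}) (hS 0) (by simp)
    have h₃ := f.rk_mono g (S.erase (e 0)) (A := {i}) (B := {i, e 0}) (by simp)
    have h₄ := ih (fun l => e l.succ) (fun a b h => Fin.succ_injective _ (he h))
      (fun l => hei _) (S.erase (e 0))
      (fun l => Finset.mem_erase.2 ⟨fun h => Fin.succ_ne_zero l (he h), hS _⟩)
    rw [Finset.card_singleton, one_mul, Finset.card_pair (hei 0).symm] at h₁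
    have h₅ : (f.dim (e 0) : ℝ) + f.rk g (S.erase (e 0)) {i} ≤ 2 * f.rk g S {i} := by
      exact_mod_cast (by omega : f.dim (e 0) + f.rk g (S.erase (e 0)) {i} ≤ 2 * f.rk g S {i})
    have h₆ : ∑ l : Fin r, (f.dim (e l.succ) : ℝ) / 2 ^ ((l.succ : ℕ) + 1)
        = (∑ l : Fin r, (f.dim (e l.succ) : ℝ) / 2 ^ ((l : ℕ) + 1)) / 2 := by
      rw [Finset.sum_div]
      refine Finset.sum_congr rfl fun l _ => ?_
      rw [Fin.val_succ, pow_succ _ ((l : ℕ) + 1), div_mul_eq_div_div]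
    rw [Fin.sum_univ_succ, h₆]
    simp only [Fin.val_zero, zero_add, pow_one]
    linarith

theorem rk_div_card_le (hg : f.Generic g) (S : Finset (Fin k)) {A B : Finset (Fin k)}
    (hAB : A ⊆ B) (hA : ∀ a ∈ A, I a = CSITState.D) (hne : A.Nonempty) :
    (f.rk g S B : ℝ) / B.card ≤ (f.rk g S A : ℝ) / A.card := by
  have hA₀ : (0 : ℝ) < A.card := by exact_mod_cast hne.card_pos
  have hB₀ : (0 : ℝ) < B.card := by exact_mod_cast (hne.mono hAB).card_pos
  rw [div_le_div_iff₀ hB₀ hA₀]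
  have h := hg.card_mul_rk_le S hAB hA
  have h' : (A.card : ℝ) * f.rk g S B ≤ B.card * f.rk g S A := by exact_mod_cast h
  linarith

theorem sum_dim_div_le_rk_div_card (hg : f.Generic g) (hsep : ∀ j, f.Separates g j)
    {P : Finset (Fin k)} {r : ℕ} (e : Fin r → Fin k) (he : Function.Injective e)
    (heD : ∀ l, I (e l) = CSITState.D) (A : Finset (Fin k)) (hA : ∀ a ∈ A, I a = CSITState.D)
    (hne : A.Nonempty) (heA : ∀ l, e l ∉ A) (heP : ∀ l, e l ∉ P) (S : Finset (Fin k))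
    (hP : P ⊆ S) (hS : ∀ l, e l ∈ S) :
    ∑ l, (f.dim (e l) : ℝ) / (A.card + 1 + (l : ℕ)) + (∑ j ∈ P, (f.dim j : ℝ)) / k
      ≤ (f.rk g S A : ℝ) / A.card := by
  induction r generalizing S A with
  | zero =>
    refine le_trans ?_ (rk_div_card_le hg S (Finset.subset_union_left (s₂ := P)) hA hne)
    have hU : (A ∪ P).Nonempty := hne.mono Finset.subset_union_left
    have hcard : ((A ∪ P).card : ℝ) ≤ k := by
      exact_mod_cast (Finset.card_le_univ _).trans_eq (Fintype.card_fin k)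
    have h₁ : ∑ j ∈ P, (f.dim j : ℝ) ≤ f.rk g S (A ∪ P) := by
      exact_mod_cast sum_dim_le_rk hsep P hP Finset.subset_union_right
    have h₂ : (0 : ℝ) < (A ∪ P).card := by exact_mod_cast hU.card_pos
    rw [Finset.univ_eq_empty, Finset.sum_empty, zero_add]
    gcongr
  | succ r ih =>
    have hA' : ∀ a ∈ insert (e 0) A, I a = CSITState.D := by
      intro a ha
      rcases Finset.mem_insert.1 ha with rfl | ha
      · exact heD 0
      · exact hA a ha
    have h₁ := rk_div_card_le hg S (Finset.subset_insert (e 0) A) hA hne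
    have h₂ := (hsep (e 0)).dim_add_rk_le (hS 0) (Finset.mem_insert_self (e 0) A)
    have h₃ := ih (fun l => e l.succ) (fun a b h => Fin.succ_injective _ (he h))
      (fun l => heD _) (insert (e 0) A) hA' (Finset.insert_nonempty _ _)
      (fun l h => by
        rcases Finset.mem_insert.1 h with h | h
        · exact Fin.succ_ne_zero l (he h)
        · exact heA _ h)
      (fun l => heP _) (S.erase (e 0))
      (fun j hj => Finset.mem_erase.2 ⟨fun h => heP 0 (h ▸ hj), hP hj⟩)
      (fun l => Finset.mem_erase.2 ⟨fun h => Fin.succ_ne_zero l (he h), hS _⟩)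
    rw [Finset.card_insert_of_notMem (heA 0)] at h₁ h₃
    push_cast at h₁ h₃
    have h₄ : ((f.dim (e 0) : ℝ) + f.rk g (S.erase (e 0)) (insert (e 0) A)) / (A.card + 1)
        ≤ f.rk g S (insert (e 0) A) / (A.card + 1) := by
      gcongr
      exact_mod_cast h₂
    have h₅ : ∑ l : Fin r, (f.dim (e l.succ) : ℝ) / (A.card + 1 + (l.succ : ℕ))
        = ∑ l : Fin r, (f.dim (e l.succ) : ℝ) / (A.card + 1 + 1 + (l : ℕ)) := by
      refine Finset.sum_congr rfl fun l _ => ?_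
      rw [Fin.val_succ]
      push_cast
      ring
    rw [Fin.sum_univ_succ, h₅]
    rw [add_div] at h₄
    simp only [Fin.val_zero, Nat.cast_zero, add_zero]
    linarith

/-- MAT-type bound: alignment at the delayed CSIT receivers, taken in the order `e`. -/
theorem sum_dim_div_le_rk_singleton (hg : f.Generic g) (hsep : ∀ j, f.Separates g j)
    {P : Finset (Fin k)} {r : ℕ} (e : Fin (r + 1) → Fin k) (he : Function.Injective e)
    (heD : ∀ l, I (e l) = CSITState.D) (heP : ∀ l, e l ∉ P) (S : Finset (Fin k))
    (hP : P ⊆ S) (hS : ∀ l, e l ∈ S) :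
    (∑ j ∈ P, (f.dim j : ℝ)) / k + ∑ l, (f.dim (e l) : ℝ) / ((l : ℕ) + 1)
      ≤ f.rk g S {e 0} := by
  have h₁ := sum_dim_div_le_rk_div_card hg hsep (P := P) (fun l : Fin r => e l.succ)
    (fun a b h => Fin.succ_injective _ (he h)) (fun l => heD _) {e 0} (by simpa using heD 0)
    (by simp) (fun l h => Fin.succ_ne_zero l (he (Finset.mem_singleton.1 h))) (fun l => heP _)
    (S.erase (e 0)) (fun j hj => Finset.mem_erase.2 ⟨fun h => heP 0 (h ▸ hj), hP hj⟩)
    (fun l => Finset.mem_erase.2 ⟨fun h => Fin.succ_ne_zero l (he h), hS _⟩)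
  have h₂ : (f.dim (e 0) : ℝ) + f.rk g (S.erase (e 0)) {e 0} ≤ f.rk g S {e 0} := by
    exact_mod_cast (hsep (e 0)).dim_add_rk_le (hS 0) (Finset.mem_singleton_self (e 0))
  have h₃ : ∑ l : Fin r, (f.dim (e l.succ) : ℝ) / ((l.succ : ℕ) + 1)
      = ∑ l : Fin r, (f.dim (e l.succ) : ℝ) / (1 + 1 + (l : ℕ)) := by
    refine Finset.sum_congr rfl fun l _ => ?_
    rw [Fin.val_succ]
    push_cast
    ring
  simp only [Finset.card_singleton, Nat.cast_one, div_one] at h₁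
  rw [Fin.sum_univ_succ, h₃]
  simp only [Fin.val_zero, Nat.cast_zero, zero_add, div_one]
  linarith

end Strategy

namespace Strategy

variable {k m n : ℕ} {I : Fin k → CSITState} {f : Strategy k m n I}

theorem Decodable.exists_generic {μ : Measure ℂ} [IsProbabilityMeasure μ] [NullSingletonClass μ]
    (h : f.Decodable μ) : ∃ g, f.Generic g ∧ ∀ j, f.Separates g j := by
  have : IsProbabilityMeasure (chanMeasure k m n μ) := by
    unfold chanMeasure
    infer_instance
  obtain ⟨g, hg, hd⟩ := ((f.ae_generic μ).and (ae_all_iff.2 h)).exists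
  exact ⟨g, hg, fun j => f.separates_of_rank_eq (hd j)⟩

theorem sum_stateN_dim_add_rk_le {g : Chan k m n} (hg : f.Generic g)
    (hsep : ∀ j, f.Separates g j) (i : Fin k) :
    (f.rk g (stateP k I ∪ stateD k I) {i} : ℝ) + ∑ j ∈ stateN k I, (f.dim j : ℝ) ≤ n := by
  have h := sum_dim_noCSIT_add_rk_le hg hsep (stateN k I) (by simp [stateN]) i
  have hc : Finset.univ \ stateN k I = stateP k I ∪ stateD k I := by
    ext j
    cases hj : I j <;> simp [stateP, stateD, stateN, hj]
  rw [hc] at h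
  rw [add_comm]
  exact_mod_cast h

/-- Interference-decomposition bound. -/
theorem Decodable.sum_div_two_pow_add_le {μ : Measure ℂ} [IsProbabilityMeasure μ]
    [NullSingletonClass μ] (h : f.Decodable μ) {i : Fin k} (hi : i ∈ stateD k I)
    (e : Fin (((stateP k I ∪ stateD k I).erase i).card) ≃
      {x // x ∈ (stateP k I ∪ stateD k I).erase i}) :
    (∑ j, (f.dim (e j).1 : ℝ) / (2 : ℝ) ^ ((j : ℕ) + 1)) + f.dim i
      + ∑ j ∈ stateN k I, (f.dim j : ℝ) ≤ n := by
  obtain ⟨g, hg, hsep⟩ := h.exists_generic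
  have h₁ := sum_stateN_dim_add_rk_le hg hsep i
  have h₂ : (f.dim i : ℝ) + f.rk g ((stateP k I ∪ stateD k I).erase i) {i}
      ≤ f.rk g (stateP k I ∪ stateD k I) {i} := by
    exact_mod_cast (hsep i).dim_add_rk_le (Finset.mem_union_right _ hi)
      (Finset.mem_singleton_self i)
  have h₃ := sum_dim_div_two_pow_le_rk hg hsep (by simpa [stateD] using hi)
    (fun j => (e j).1) (Subtype.val_injective.comp e.injective)
    (fun j => (Finset.mem_erase.1 (e j).2).1) _ (fun j => (e j).2)
  linarith

/-- Bound without any alignment. -/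
theorem Decodable.dim_add_sum_stateN_le {μ : Measure ℂ} [IsProbabilityMeasure μ]
    [NullSingletonClass μ] (h : f.Decodable μ) {i : Fin k}
    (hi : i ∈ stateP k I ∪ stateD k I) :
    (f.dim i : ℝ) + ∑ j ∈ stateN k I, (f.dim j : ℝ) ≤ n := by
  obtain ⟨g, hg, hsep⟩ := h.exists_generic
  have h₁ := sum_stateN_dim_add_rk_le hg hsep i
  have h₂ : (f.dim i : ℝ) + f.rk g ((stateP k I ∪ stateD k I).erase i) {i}
      ≤ f.rk g (stateP k I ∪ stateD k I) {i} := by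
    exact_mod_cast (hsep i).dim_add_rk_le hi (Finset.mem_singleton_self i)
  have h₃ : (0 : ℝ) ≤ f.rk g ((stateP k I ∪ stateD k I).erase i) {i} := Nat.cast_nonneg _
  linarith

theorem Decodable.sum_stateP_div_add_sum_stateN_le {μ : Measure ℂ} [IsProbabilityMeasure μ]
    [NullSingletonClass μ] (h : f.Decodable μ) :
    (∑ j ∈ stateP k I, (f.dim j : ℝ) / k) + ∑ j ∈ stateN k I, (f.dim j : ℝ) ≤ n := by
  obtain ⟨g, hg, hsep⟩ := h.exists_generic
  have hN : ∑ j ∈ stateN k I, (f.dim j : ℝ) ≤ n := by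
    exact_mod_cast sum_dim_noCSIT_le hg hsep (stateN k I) (by simp [stateN])
  have hP : ∑ j ∈ stateP k I, (f.dim j : ℝ)
      ≤ (stateP k I).card * (n - ∑ j ∈ stateN k I, (f.dim j : ℝ)) := by
    rw [← nsmul_eq_mul]
    refine Finset.sum_le_card_nsmul _ _ _ fun j hj => ?_
    linarith [h.dim_add_sum_stateN_le (Finset.mem_union_left _ hj)]
  have hcard : ((stateP k I).card : ℝ) ≤ k := by
    exact_mod_cast (Finset.card_le_univ _).trans_eq (Fintype.card_fin k)
  have hle : (∑ j ∈ stateP k I, (f.dim j : ℝ)) / k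
      ≤ n - ∑ j ∈ stateN k I, (f.dim j : ℝ) := by
    refine div_le_of_le_mul₀ (Nat.cast_nonneg k) (by linarith) (hP.trans ?_)
    rw [mul_comm]
    exact mul_le_mul_of_nonneg_left hcard (by linarith)
  rw [← Finset.sum_div]
  linarith

/-- MAT-type bound. -/
theorem Decodable.sum_div_add_sum_div_add_le {μ : Measure ℂ} [IsProbabilityMeasure μ]
    [NullSingletonClass μ] (h : f.Decodable μ) {r : ℕ} (e : Fin r ≃ {x // x ∈ stateD k I}) :
    (∑ j ∈ stateP k I, (f.dim j : ℝ) / k) + (∑ j, (f.dim (e j).1 : ℝ) / ((j : ℕ) + 1 : ℝ))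
      + ∑ j ∈ stateN k I, (f.dim j : ℝ) ≤ n := by
  cases r with
  | zero => simpa using h.sum_stateP_div_add_sum_stateN_le
  | succ r =>
    obtain ⟨g, hg, hsep⟩ := h.exists_generic
    have heD : ∀ l, I (e l).1 = CSITState.D := fun l => (Finset.mem_filter.1 (e l).2).2
    have h₁ := sum_stateN_dim_add_rk_le hg hsep (e 0).1
    have h₂ := sum_dim_div_le_rk_singleton hg hsep (P := stateP k I) (fun l => (e l).1)
      (Subtype.val_injective.comp e.injective) heD (fun l => by simp [stateP, heD])
      (stateP k I ∪ stateD k I) Finset.subset_union_left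
      (fun l => Finset.mem_union_right _ (e l).2)
    rw [Finset.sum_div] at h₂
    linarith

end Strategy

/-- Homogeneous inequalities between symbol counts and block length pass to the region. -/
theorem le_one_of_mem_LDoFRegion {k m : ℕ} {I : Fin k → CSITState} {μ : Measure ℂ}
    {L : (Fin k → ℝ) → ℝ} (hL : Continuous L) (hhom : ∀ (c : ℝ) x, L (c • x) = c * L x)
    (hb : ∀ (n : ℕ) (f : Strategy k m n I), f.Decodable μ → L (fun j => f.dim j) ≤ n)
    {d : Fin k → ℝ} (hd : d ∈ LDoFRegion k m I μ) : L d ≤ 1 := by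
  refine closure_minimal (t := {d | L d ≤ 1}) ?_ (isClosed_le hL continuous_const) hd
  rintro d ⟨-, F, hF, hlim⟩
  refine le_of_tendsto ((hL.tendsto d).comp (tendsto_pi_nhds.2 hlim)) ?_
  filter_upwards [eventually_gt_atTop 0] with n hn
  have hn' : (0 : ℝ) < n := by exact_mod_cast hn
  have h : (fun j => ((F n).dim j : ℝ) / n) = (n : ℝ)⁻¹ • fun j => ((F n).dim j : ℝ) := by
    funext j
    simp [div_eq_inv_mul]
  rw [Function.comp_apply, h, hhom, inv_mul_le_one₀ hn']
  exact hb n _ (hF n)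

/-- **Theorem 2 (outer bound for the k-user MISO BC with hybrid CSIT).** For any hybrid
CSIT configuration `I`, the linear DoF region is contained in the polytope described by
the interference-decomposition, MAT-type, and no-CSIT bounds. -/
theorem ldof_region_k_user_outer (k m : ℕ) (hkm : k ≤ m) (I : Fin k → CSITState)
    (μ : Measure ℂ) [IsProbabilityMeasure μ] (hac : μ ≪ (volume : Measure ℂ)) :
    LDoFRegion k m I μ ⊆
      { d : Fin k → ℝ |
        (∀ i, 0 ≤ d i ∧ d i ≤ 1) ∧
        (∀ i ∈ stateD k I,
          ∀ e : Fin (((stateP k I ∪ stateD k I).erase i).card) ≃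
              {x // x ∈ (stateP k I ∪ stateD k I).erase i},
            (∑ j, d (e j).1 / (2 : ℝ) ^ ((j : ℕ) + 1)) + d i + ∑ j ∈ stateN k I, d j ≤ 1) ∧
        (∀ e : Fin ((stateD k I).card) ≃ {x // x ∈ stateD k I},
            (∑ j ∈ stateP k I, d j / (k : ℝ)) +
              (∑ j, d (e j).1 / ((j : ℕ) + 1 : ℝ)) +
              ∑ j ∈ stateN k I, d j ≤ 1) ∧
        (∀ i ∈ stateP k I ∪ stateD k I, d i + ∑ j ∈ stateN k I, d j ≤ 1) } := by
  have : NullSingletonClass μ := ⟨fun x => hac (measure_singleton x)⟩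
  intro d hd
  refine ⟨fun i => ?_, fun i hi e => ?_, fun e => ?_, fun i hi => ?_⟩
  · refine closure_minimal (t := {d : Fin k → ℝ | 0 ≤ d i ∧ d i ≤ 1}) (fun d hd => hd.1 i) ?_ hd
    exact (isClosed_le continuous_const (continuous_apply i)).inter
      (isClosed_le (continuous_apply i) continuous_const)
  · refine le_one_of_mem_LDoFRegion (L := fun d : Fin k → ℝ =>
      (∑ j, d (e j).1 / (2 : ℝ) ^ ((j : ℕ) + 1)) + d i + ∑ j ∈ stateN k I, d j)
      (by fun_prop) (fun c x => ?_) (fun n f h => h.sum_div_two_pow_add_le hi e) hd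
    simp only [Pi.smul_apply, smul_eq_mul, mul_add, Finset.mul_sum, mul_div_assoc]
  · refine le_one_of_mem_LDoFRegion (L := fun d : Fin k → ℝ =>
      (∑ j ∈ stateP k I, d j / (k : ℝ)) + (∑ j, d (e j).1 / ((j : ℕ) + 1 : ℝ))
        + ∑ j ∈ stateN k I, d j)
      (by fun_prop) (fun c x => ?_) (fun n f h => h.sum_div_add_sum_div_add_le e) hd
    simp only [Pi.smul_apply, smul_eq_mul, mul_add, Finset.mul_sum, mul_div_assoc]
  · refine le_one_of_mem_LDoFRegion (L := fun d : Fin k → ℝ => d i + ∑ j ∈ stateN k I, d j)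
      (by fun_prop) (fun c x => ?_) (fun n f h => h.dim_add_sum_stateN_le hi) hd
    simp only [Pi.smul_apply, smul_eq_mul, mul_add, Finset.mul_sum]

end
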